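/- Let n ≥ 1 and suppose the zero set D of H_n consists of n distinct real numbers. Then for every z ∈ D, the cubature weight satisfies λ_z = (n−1)! / (n · H_{n−1}(z)²), where λ_z = ∫ l_z dγ. -/

import Mathlib

open MeasureTheory Polynomial ProbabilityTheory

/-- The probabilists' Hermite polynomials, defined by `H_0 = 1`, `H_1 = X` and the
three-term recurrence `H_{n+1}(x) = x·H_n(x) − n·H_{n−1}(x)`. -/
noncomputable def hermiteR : ℕ → Polynomial ℝ
  | 0 => 1
  | 1 => Polynomial.X
  | n + 2 => Polynomial.X * hermiteR (n + 1) - Polynomial.C ((n : ℝ) + 1) * hermiteR n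

lemma hermiteR_monic_natDegree (n : ℕ) : (hermiteR n).Monic ∧ (hermiteR n).natDegree = n := by
  induction n using Nat.twoStepInduction with
  | zero => exact ⟨monic_one, natDegree_one⟩
  | one => exact ⟨monic_X, natDegree_X⟩
  | more n ih₀ ih₁ =>
    have hX : (X * hermiteR (n + 1)).Monic := monic_X.mul ih₁.1
    have hdeg : (X * hermiteR (n + 1)).natDegree = n + 2 := by
      rw [natDegree_X_mul ih₁.1.ne_zero, ih₁.2]
    have hlt : (C ((n : ℝ) + 1) * hermiteR n).degree < (X * hermiteR (n + 1)).degree := by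
      rw [degree_eq_natDegree hX.ne_zero, hdeg]
      refine (degree_le_of_natDegree_le (natDegree_C_mul_le _ _)).trans_lt ?_
      rw [ih₀.2]
      exact_mod_cast Nat.lt_add_of_pos_right two_pos
    rw [hermiteR]
    exact ⟨hX.sub_of_left hlt,
      (natDegree_eq_of_degree_eq (degree_sub_eq_left_of_degree_lt hlt)).trans hdeg⟩

lemma derivative_hermiteR_succ (n : ℕ) :
    derivative (hermiteR (n + 1)) = C ((n : ℝ) + 1) * hermiteR n := by
  induction n using Nat.twoStepInduction with
  | zero => simp [hermiteR]
  | one => simp [hermiteR]; ring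
  | more n ih₀ ih₁ =>
    rw [hermiteR, derivative_sub, derivative_mul, derivative_C_mul, ih₀, ih₁, derivative_X]
    conv_rhs => rw [hermiteR]
    conv_lhs => rw [hermiteR]
    simp only [Nat.cast_add, Nat.cast_one, Nat.cast_ofNat, C_add, C_1, map_ofNat]
    ring

lemma hermiteR_succ (n : ℕ) :
    hermiteR (n + 1) = X * hermiteR n - derivative (hermiteR n) := by
  cases n with
  | zero => simp [hermiteR]
  | succ n => rw [derivative_hermiteR_succ, hermiteR]

lemma integrable_eval_gaussianReal (p : ℝ[X]) :
    Integrable (fun x ↦ p.eval x) (gaussianReal 0 1) := by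
  simp_rw [eval_eq_sum_range]
  refine integrable_finsetSum _ fun i _ ↦ Integrable.const_mul ?_ _
  have h := (memLp_id_gaussianReal (μ := 0) (v := 1) i).integrable_norm_pow'
  refine (integrable_norm_iff (by fun_prop)).1 ?_
  simpa using h

lemma integrable_eval_mul_gaussianPDFReal (p : ℝ[X]) :
    Integrable (fun x ↦ p.eval x * gaussianPDFReal 0 1 x) := by
  have h := integrable_eval_gaussianReal p
  rw [gaussianReal_of_var_ne_zero 0 one_ne_zero,
    integrable_withDensity_iff_integrable_smul' (measurable_gaussianPDF 0 1)
      (Filter.Eventually.of_forall fun _ ↦ gaussianPDF_lt_top)] at h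
  simpa [mul_comm] using h

lemma hasDerivAt_gaussianPDFReal_zero_one (x : ℝ) :
    HasDerivAt (gaussianPDFReal 0 1) (-x * gaussianPDFReal 0 1 x) x := by
  have h : HasDerivAt (fun y : ℝ ↦ -(y - 0) ^ 2 / (2 * ((1 : NNReal) : ℝ))) (-x) x := by
    refine ((((hasDerivAt_id x).sub_const 0).pow 2).neg.div_const
      (2 * ((1 : NNReal) : ℝ))).congr_deriv ?_
    simp
    ring
  rw [gaussianPDFReal_def]
  refine (h.exp.const_mul ((√(2 * Real.pi * ((1 : NNReal) : ℝ)))⁻¹)).congr_deriv ?_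
  ring

/-- The Stein identity for polynomials. -/
lemma integral_X_mul_gaussianReal (p : ℝ[X]) :
    ∫ x, (X * p).eval x ∂gaussianReal 0 1 = ∫ x, (derivative p).eval x ∂gaussianReal 0 1 := by
  rw [← sub_eq_zero, ← integral_sub (integrable_eval_gaussianReal _)
    (integrable_eval_gaussianReal _), ← neg_eq_zero, ← integral_neg,
    integral_gaussianReal_eq_integral_smul one_ne_zero]
  have hderiv (x : ℝ) : HasDerivAt (fun x ↦ p.eval x * gaussianPDFReal 0 1 x)
      ((derivative p - X * p).eval x * gaussianPDFReal 0 1 x) x := by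
    refine ((p.hasDerivAt x).mul (hasDerivAt_gaussianPDFReal_zero_one x)).congr_deriv ?_
    simp only [eval_sub, eval_mul, eval_X]
    ring
  refine Eq.trans (integral_congr_ae (Filter.Eventually.of_forall fun x ↦ ?_))
    (integral_eq_zero_of_hasDerivAt_of_integrable hderiv
      (integrable_eval_mul_gaussianPDFReal _) (integrable_eval_mul_gaussianPDFReal _))
  simp only [eval_sub, smul_eq_mul]
  ring

lemma integral_hermiteR_mul (n : ℕ) (q : ℝ[X]) :
    ∫ x, (hermiteR n * q).eval x ∂gaussianReal 0 1 =
      ∫ x, (derivative^[n] q).eval x ∂gaussianReal 0 1 := by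
  induction n generalizing q with
  | zero => simp [hermiteR]
  | succ n ih =>
    have hq : hermiteR (n + 1) * q =
        X * (hermiteR n * q) - derivative (hermiteR n) * q := by
      rw [hermiteR_succ]; ring
    rw [Function.iterate_succ_apply, ← ih, hq]
    simp_rw [eval_sub]
    rw [integral_sub (integrable_eval_gaussianReal _) (integrable_eval_gaussianReal _),
      integral_X_mul_gaussianReal, ← integral_sub (integrable_eval_gaussianReal _)
      (integrable_eval_gaussianReal _)]
    congr 1 with x
    rw [derivative_mul, eval_add]
    ring

lemma integral_hermiteR_mul_of_natDegree_le {n : ℕ} {q : ℝ[X]} (hq : q.natDegree ≤ n) :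
    ∫ x, (hermiteR n * q).eval x ∂gaussianReal 0 1 = n.factorial * q.coeff n := by
  have hdeg : (derivative^[n] q).natDegree ≤ 0 :=
    (natDegree_iterate_derivative q n).trans (by omega)
  rw [integral_hermiteR_mul, eq_C_of_natDegree_le_zero hdeg, coeff_iterate_derivative]
  simp [Nat.descFactorial_self]

lemma hermiteR_eq_nodal {n : ℕ} {D : Finset ℝ} (hcard : D.card = n)
    (hzero : ∀ x ∈ D, (hermiteR n).eval x = 0) : hermiteR n = Lagrange.nodal D id := by
  obtain ⟨hm, hdeg⟩ := hermiteR_monic_natDegree n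
  have hdeg' : (hermiteR n).degree = D.card := by
    rw [degree_eq_natDegree hm.ne_zero, hdeg, hcard]
  refine eq_of_degree_le_of_eval_finset_eq D hdeg'.le ?_ ?_ fun x hx ↦ ?_
  · rw [hdeg', Lagrange.degree_nodal]
  · rw [hm.leadingCoeff, Lagrange.nodal_monic.leadingCoeff]
  · rw [hzero x hx]
    exact (Lagrange.eval_nodal_at_node (v := id) hx).symm

/-- Explicit cubature weights for Gauss–Hermite quadrature: if `D` is the
zero set of `H_n` (with `n` distinct points), then for every `z ∈ D`,
`λ_z = ∫ l_z dγ = (n−1)! / (n · H_{n−1}(z)²)`. -/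
theorem hermite_quadrature_weights
    (n : ℕ) (hn : 1 ≤ n)
    (D : Finset ℝ) (hcard : D.card = n)
    (hzero : ∀ x : ℝ, x ∈ D ↔ (hermiteR n).eval x = 0) :
    ∀ z ∈ D,
      ∫ x, (Lagrange.basis D id z).eval x ∂(gaussianReal 0 1) =
        (Nat.factorial (n - 1) : ℝ) / ((n : ℝ) * ((hermiteR (n - 1)).eval z) ^ 2) := by
  intro z hz
  obtain ⟨m, rfl⟩ : ∃ m, n = m + 1 := ⟨n - 1, by omega⟩
  simp only [Nat.add_sub_cancel]
  set w := Lagrange.nodalWeight D id z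
  set M := Lagrange.nodal (D.erase z) (id : ℝ → ℝ)
  set c := (hermiteR m).eval z
  have hnodal := hermiteR_eq_nodal hcard fun x hx ↦ (hzero x).1 hx
  have hinj : Set.InjOn (id : ℝ → ℝ) D := Function.injective_id.injOn
  have hw : w = ((m + 1 : ℝ) * c)⁻¹ := by
    simp [w, c, Lagrange.nodalWeight_eq_eval_derivative_nodal hz, ← hnodal,
      derivative_hermiteR_succ]
  have hw0 : w ≠ 0 := Lagrange.nodalWeight_ne_zero hinj hz
  have hbasis : Lagrange.basis D id z = C w * M := by
    rw [Lagrange.basis_eq_prod_sub_inv_mul_nodal_div hz, ← Lagrange.nodal_erase_eq_nodal_div hz]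
  have hMdeg : M.natDegree = m := by
    rw [Lagrange.natDegree_nodal, Finset.card_erase_of_mem hz, hcard, Nat.add_sub_cancel]
  have hMcoeff : M.coeff m = 1 := hMdeg ▸ Lagrange.nodal_monic.coeff_natDegree
  have hfactor : hermiteR (m + 1) = (X - C z) * M := by
    rw [hnodal, Lagrange.nodal_eq_mul_nodal_erase hz, id]
  set r := (hermiteR m - C c) /ₘ (X - C z)
  have hr : (X - C z) * r = hermiteR m - C c :=
    mul_divByMonic_eq_iff_isRoot.2 (by simp [c])
  have hrdeg : r.natDegree < m + 1 := by
    rw [natDegree_divByMonic _ (monic_X_sub_C z), natDegree_sub_C,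
      (hermiteR_monic_natDegree m).2]
    omega
  have hsplit : hermiteR m * (C w * M) = C c * (C w * M) + hermiteR (m + 1) * (C w * r) := by
    rw [hfactor]
    linear_combination (-(C w * M)) * hr
  have hmain := integral_hermiteR_mul_of_natDegree_le
    ((natDegree_C_mul_le w M).trans hMdeg.le)
  have hrest := integral_hermiteR_mul_of_natDegree_le
    ((natDegree_C_mul_le w r).trans hrdeg.le)
  rw [coeff_C_mul, coeff_eq_zero_of_natDegree_lt hrdeg] at hrest
  simp_rw [hsplit, eval_add] at hmain
  rw [integral_add (integrable_eval_gaussianReal _) (integrable_eval_gaussianReal _),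
    hrest] at hmain
  simp_rw [eval_C_mul (p := C w * M)] at hmain
  rw [integral_const_mul, coeff_C_mul, hMcoeff] at hmain
  rw [hbasis]
  have hc : c ≠ 0 := by
    intro h
    exact hw0 (by simp [hw, h])
  have hcw : w * ((m + 1 : ℝ) * c) = 1 := by rw [hw]; field_simp
  push_cast
  rw [eq_div_iff (by positivity)]
  linear_combination (m + 1 : ℝ) * c * hmain + (m.factorial : ℝ) * hcw
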